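/- arXiv:2411.09919 — 9 statements merged into one kernel-verified Lean document; each statement's English description precedes it below -/
import Mathlib

section
/- Let S = {ρ_1, …, ρ_N} be a finite non-orthogonal set of pure states on a finite-dimensional complex Hilbert space. Then S is weakly antidistinguishable if and only if S is contextual. -/
open Matrix

/-- Square complex matrices of size `d`, acting on the Hilbert space `ℂ^d`. -/
abbrev Mat (d : ℕ) := Matrix (Fin d) (Fin d) ℂ

/-- An orthogonal projection. -/
def IsProjection {d : ℕ} (p : Mat d) : Prop := p.IsHermitian ∧ p * p = p

/-- A pure state: a rank-1 orthogonal projection `|ψ⟩⟨ψ|` for a unit vector `ψ`. -/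
def IsPureState {d : ℕ} (ρ : Mat d) : Prop :=
  ∃ ψ : Fin d → ℂ, star ψ ⬝ᵥ ψ = 1 ∧ ρ = vecMulVec ψ (star ψ)

/-- A PVM: a finite family of orthogonal projections, pairwise orthogonal, summing to `1`. -/
def IsPVM {d : ℕ} (P : Finset (Mat d)) : Prop :=
  (∀ p ∈ P, IsProjection p) ∧
  (∀ p ∈ P, ∀ q ∈ P, p ≠ q → p * q = 0) ∧
  ∑ p ∈ P, p = 1

/-- A PVM given as an indexed family. -/
def IsPVMFam {d : ℕ} {ι : Type} [Fintype ι] (π : ι → Mat d) : Prop :=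
  (∀ i, IsProjection (π i)) ∧ (∀ i j, i ≠ j → π i * π j = 0) ∧ ∑ i, π i = 1

/-- `P` weakly antidistinguishes `S`: every outcome of `P` excludes some state of `S`. -/
def WeaklyAntidistinguishes {d : ℕ} (P S : Finset (Mat d)) : Prop :=
  ∀ p ∈ P, ∃ ρ ∈ S, (p * ρ).trace = 0

/-- `S` is weakly antidistinguishable. -/
def IsWA {d : ℕ} (S : Finset (Mat d)) : Prop :=
  ∃ P : Finset (Mat d), IsPVM P ∧ WeaklyAntidistinguishes P S

/-- `P` strongly antidistinguishes `S`: it weakly antidistinguishes `S` and for each state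
there is an outcome excluding that state and no other. -/
def StronglyAntidistinguishes {d : ℕ} (P S : Finset (Mat d)) : Prop :=
  WeaklyAntidistinguishes P S ∧
  ∀ ρ ∈ S, ∃ p ∈ P, (p * ρ).trace = 0 ∧ ∀ ρ' ∈ S, ρ' ≠ ρ → (p * ρ').trace ≠ 0

/-- `S` is strongly antidistinguishable. -/
def IsSA {d : ℕ} (S : Finset (Mat d)) : Prop :=
  ∃ P : Finset (Mat d), IsPVM P ∧ StronglyAntidistinguishes P S

/-- `S = {ρ_1, …, ρ_N}` is antidistinguishable: there is a PVM `{π_i}_{i=1}^N`, with one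
outcome per state, such that `Tr(π_i ρ_i) = 0` for each `i`. -/
def IsA {d : ℕ} (S : Finset (Mat d)) : Prop :=
  ∃ π : Mat d → Mat d,
    (∀ ρ ∈ S, IsProjection (π ρ)) ∧
    (∀ ρ ∈ S, ∀ ρ' ∈ S, ρ ≠ ρ' → π ρ * π ρ' = 0) ∧
    (∑ ρ ∈ S, π ρ = 1) ∧
    ∀ ρ ∈ S, (π ρ * ρ).trace = 0

/-- A context: a finite set of rank-1 orthogonal projections, pairwise orthogonal,
summing to the identity. -/
def IsContext {d : ℕ} (C : Finset (Mat d)) : Prop :=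
  (∀ p ∈ C, IsPureState p) ∧
  (∀ p ∈ C, ∀ q ∈ C, p ≠ q → p * q = 0) ∧
  ∑ p ∈ C, p = 1

/-- A `{0,1}`-valued assignment on `X` such that every context drawn from `X`
has exactly one vertex assigned the value `1`. -/
def NoncontextualAssignment {d : ℕ} (X : Finset (Mat d)) (ν : Mat d → ℕ) : Prop :=
  (∀ σ ∈ X, ν σ = 0 ∨ ν σ = 1) ∧
  ∀ C ⊆ X, IsContext C → ∑ σ ∈ C, ν σ = 1

/-- `σ` is an implied projector of `S`: a rank-1 projection orthogonal to some state of `S`. -/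
def ImpliedProjector {d : ℕ} (S : Finset (Mat d)) (σ : Mat d) : Prop :=
  IsPureState σ ∧ ∃ ρ ∈ S, ρ * σ = 0

/-- `X` is a contextuality scenario generated by `S`: a finite set of rank-1 projections
with `S ⊆ X` and `X \ S ⊆ I(S)`. -/
def GeneratedScenario {d : ℕ} (S X : Finset (Mat d)) : Prop :=
  (∀ σ ∈ X, IsPureState σ) ∧ S ⊆ X ∧ ∀ σ ∈ X, σ ∉ S → ImpliedProjector S σ

/-- `S` is a contextual instance of the scenario `X`: there is no noncontextual value
assignment on `X` assigning `1` to every state of `S`. -/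
def ContextualInstance {d : ℕ} (S X : Finset (Mat d)) : Prop :=
  ¬ ∃ ν : Mat d → ℕ, NoncontextualAssignment X ν ∧ ∀ ρ ∈ S, ν ρ = 1

/-- `S` is contextual: some scenario generated by `S` has `S` as a contextual instance. -/
def IsContextualSet {d : ℕ} (S : Finset (Mat d)) : Prop :=
  ∃ X : Finset (Mat d), GeneratedScenario S X ∧ ContextualInstance S X

/-- `S` is non-orthogonal: distinct states have nonzero overlap. -/
def NonOrthogonal {d : ℕ} (S : Finset (Mat d)) : Prop :=
  ∀ ρ ∈ S, ∀ ρ' ∈ S, ρ ≠ ρ' → (ρ * ρ').trace ≠ 0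

/-- `S` is maximally contextual: `S` is contextual and no proper subset of `S` is. -/
def MaximallyContextual {d : ℕ} (S : Finset (Mat d)) : Prop :=
  IsContextualSet S ∧ ∀ S' ⊂ S, ¬ IsContextualSet S'

theorem IsPureState.isProjection {d : ℕ} {ρ : Mat d} (h : IsPureState ρ) : IsProjection ρ := by
  obtain ⟨ψ, hψ, rfl⟩ := h
  refine ⟨by simp [IsHermitian, conjTranspose_vecMulVec], ?_⟩
  rw [vecMulVec_mul_vecMulVec, hψ, one_smul]

theorem IsPureState.trace_eq_one {d : ℕ} {ρ : Mat d} (h : IsPureState ρ) : ρ.trace = 1 := by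
  obtain ⟨ψ, hψ, rfl⟩ := h
  rw [trace_vecMulVec, dotProduct_comm, hψ]

theorem IsPureState.mul_self_ne_zero {d : ℕ} {ρ : Mat d} (h : IsPureState ρ) : ρ * ρ ≠ 0 := by
  intro h0
  have := h.trace_eq_one
  rw [← h.isProjection.2, h0, trace_zero] at this
  exact zero_ne_one this

theorem IsProjection.mul_eq_zero_comm {d : ℕ} {p q : Mat d} (hp : IsProjection p)
    (hq : IsProjection q) (h : p * q = 0) : q * p = 0 := by
  simpa [conjTranspose_mul, hp.1.eq, hq.1.eq] using congrArg conjTranspose h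

open scoped ComplexOrder in
theorem IsProjection.mul_eq_zero_of_trace {d : ℕ} {p q : Mat d} (hp : IsProjection p)
    (hq : IsProjection q) (h : (p * q).trace = 0) : p * q = 0 := by
  rw [← trace_conjTranspose_mul_self_eq_zero_iff, conjTranspose_mul, hp.1.eq, hq.1.eq]
  rw [show q * p * (p * q) = q * (p * p * q) by simp only [mul_assoc], hp.2, trace_mul_comm,
    mul_assoc, hq.2, h]

/-- Every orthogonal projection is a sum of pairwise orthogonal pure states. -/
theorem IsProjection.exists_pure_decomposition {d : ℕ} {p : Mat d} (hp : IsProjection p) :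
    ∃ T : Finset (Mat d), (∀ σ ∈ T, IsPureState σ) ∧
      (∀ σ ∈ T, ∀ τ ∈ T, σ ≠ τ → σ * τ = 0) ∧ ∑ σ ∈ T, σ = p := by
  classical
  obtain ⟨U, hUU, l, hspec⟩ : ∃ U : Mat d, Uᴴ * U = 1 ∧ ∃ l : Fin d → ℂ,
      p = U * diagonal l * Uᴴ :=
    ⟨_, Unitary.coe_star_mul_self hp.1.eigenvectorUnitary, _, by
      simpa [Unitary.conjStarAlgAut_apply, star_eq_conjTranspose] using hp.1.spectral_theorem⟩
  have horth (i j : Fin d) : star (U.col i) ⬝ᵥ U.col j = if i = j then 1 else 0 := by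
    have := congrFun (congrFun hUU i) j
    rwa [Matrix.one_apply] at this
  have hdiag : diagonal l = Uᴴ * p * U := by
    rw [hspec, show Uᴴ * (U * diagonal l * Uᴴ) * U = (Uᴴ * U) * diagonal l * (Uᴴ * U) by
      simp only [mul_assoc], hUU, one_mul, mul_one]
  have hl (i : Fin d) : l i = 0 ∨ l i = 1 := by
    have hsq : diagonal l * diagonal l = diagonal l := by
      nth_rewrite 2 [hdiag]
      rw [hdiag, show Uᴴ * p * U * (Uᴴ * p * U) = Uᴴ * p * (U * Uᴴ) * p * U by
        simp only [mul_assoc], mul_eq_one_comm.1 hUU, mul_one, mul_assoc Uᴴ, hp.2]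
    rw [diagonal_mul_diagonal] at hsq
    have hi := congrFun (diagonal_injective hsq) i
    grind
  let f : Fin d → Mat d := fun i => vecMulVec (U.col i) (star (U.col i))
  have hf (i : Fin d) : IsPureState (f i) := ⟨U.col i, by simp [horth], rfl⟩
  have hff (i j : Fin d) (hij : i ≠ j) : f i * f j = 0 := by
    simp [f, vecMulVec_mul_vecMulVec, horth, hij]
  have hinj : Function.Injective f := by
    intro i j hij
    by_contra hne
    exact (hf i).mul_self_ne_zero (by nth_rewrite 2 [hij]; exact hff i j hne)
  refine ⟨(Finset.univ.filter fun i => l i = 1).image f, ?_, ?_, ?_⟩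
  · simp only [Finset.mem_image]
    rintro _ ⟨i, -, rfl⟩
    exact hf i
  · simp only [Finset.mem_image]
    rintro _ ⟨i, -, rfl⟩ _ ⟨j, -, rfl⟩ hne
    exact hff i j fun h => hne (h ▸ rfl)
  · rw [Finset.sum_image hinj.injOn, Finset.sum_filter]
    ext j k
    rw [hspec, Matrix.sum_apply, mul_apply]
    refine Finset.sum_congr rfl fun i _ => ?_
    rcases hl i with h | h <;> simp [f, h, vecMulVec_apply, mul_diagonal]

theorem IsProjection.mul_of_mem_decomposition {d : ℕ} {p σ : Mat d} {T : Finset (Mat d)}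
    (hpure : ∀ σ ∈ T, IsPureState σ) (horth : ∀ σ ∈ T, ∀ τ ∈ T, σ ≠ τ → σ * τ = 0)
    (hsum : ∑ σ ∈ T, σ = p) (hσ : σ ∈ T) : p * σ = σ := by
  rw [← hsum, Finset.sum_mul, Finset.sum_eq_single_of_mem σ hσ fun τ hτ h => horth τ hτ σ hσ h,
    (hpure σ hσ).isProjection.2]

/-- Every PVM refines to a context. -/
theorem IsPVM.exists_context {d : ℕ} {P : Finset (Mat d)} (hP : IsPVM P) :
    ∃ C : Finset (Mat d), IsContext C ∧ ∀ σ ∈ C, ∃ p ∈ P, σ * p = σ := by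
  classical
  obtain ⟨hproj, horth, hsum⟩ := hP
  choose! T hTpure hTorth hTsum using fun p hp => (hproj p hp).exists_pure_decomposition
  have hl {p σ : Mat d} (hp : p ∈ P) (hσ : σ ∈ T p) : p * σ = σ :=
    IsProjection.mul_of_mem_decomposition (hTpure p hp) (hTorth p hp) (hTsum p hp) hσ
  have hr {p σ : Mat d} (hp : p ∈ P) (hσ : σ ∈ T p) : σ * p = σ := by
    simpa [conjTranspose_mul, (hproj p hp).1.eq, (hTpure p hp σ hσ).isProjection.1.eq] using
      congrArg conjTranspose (hl hp hσ)
  have hcross {p q σ τ : Mat d} (hp : p ∈ P) (hq : q ∈ P) (hpq : p ≠ q) (hσ : σ ∈ T p)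
      (hτ : τ ∈ T q) : σ * τ = 0 := by
    rw [← hr hp hσ, ← hl hq hτ, mul_assoc, ← mul_assoc p, horth p hp q hq hpq]
    simp
  refine ⟨P.biUnion T, ⟨?_, ?_, ?_⟩, ?_⟩
  · intro σ hσ
    obtain ⟨p, hp, hσ⟩ := Finset.mem_biUnion.1 hσ
    exact hTpure p hp σ hσ
  · intro σ hσ τ hτ hne
    obtain ⟨p, hp, hσ⟩ := Finset.mem_biUnion.1 hσ
    obtain ⟨q, hq, hτ⟩ := Finset.mem_biUnion.1 hτ
    by_cases hpq : p = q
    · subst hpq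
      exact hTorth p hp σ hσ τ hτ hne
    · exact hcross hp hq hpq hσ hτ
  · rw [Finset.sum_biUnion, Finset.sum_congr rfl hTsum, hsum]
    intro p hp q hq hpq
    refine Finset.disjoint_left.2 fun σ hσ hσ' => ?_
    exact (hTpure p hp σ hσ).mul_self_ne_zero (hcross hp hq hpq hσ hσ')
  · intro σ hσ
    obtain ⟨p, hp, hσ⟩ := Finset.mem_biUnion.1 hσ
    exact ⟨p, hp, hr hp hσ⟩

/-- Two orthogonal pure states lie in a common context. -/
theorem IsPureState.exists_context {d : ℕ} {ρ σ : Mat d} (hρ : IsPureState ρ)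
    (hσ : IsPureState σ) (h : ρ * σ = 0) :
    ∃ C : Finset (Mat d), IsContext C ∧ ρ ∈ C ∧ σ ∈ C := by
  classical
  have h' : σ * ρ = 0 := hρ.isProjection.mul_eq_zero_comm hσ.isProjection h
  have hq : IsProjection (1 - ρ - σ) := by
    refine ⟨(isHermitian_one.sub hρ.isProjection.1).sub hσ.isProjection.1, ?_⟩
    simp [sub_mul, mul_sub, h, h', hρ.isProjection.2, hσ.isProjection.2]
  obtain ⟨T, hT, hTorth, hTsum⟩ := hq.exists_pure_decomposition
  have hl {τ : Mat d} (hτ : τ ∈ T) : (1 - ρ - σ) * τ = τ :=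
    IsProjection.mul_of_mem_decomposition hT hTorth hTsum hτ
  have hρT {τ : Mat d} (hτ : τ ∈ T) : ρ * τ = 0 := by
    rw [← hl hτ, ← mul_assoc]
    simp [mul_sub, h, hρ.isProjection.2]
  have hσT {τ : Mat d} (hτ : τ ∈ T) : σ * τ = 0 := by
    rw [← hl hτ, ← mul_assoc]
    simp [mul_sub, h', hσ.isProjection.2]
  have hσn : σ ∉ T := fun hm => hσ.mul_self_ne_zero (hσT hm)
  have hρn : ρ ∉ insert σ T := by
    rw [Finset.mem_insert]
    rintro (rfl | hm)
    · exact hρ.mul_self_ne_zero h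
    · exact hρ.mul_self_ne_zero (hρT hm)
  have hcomm {a b : Mat d} (ha : IsPureState a) (hb : IsPureState b) (hab : a * b = 0) :
      b * a = 0 := ha.isProjection.mul_eq_zero_comm hb.isProjection hab
  refine ⟨insert ρ (insert σ T), ⟨?_, ?_, ?_⟩, by simp, by simp⟩
  · simp only [Finset.mem_insert]
    rintro p (rfl | rfl | hp)
    exacts [hρ, hσ, hT p hp]
  · simp only [Finset.mem_insert]
    rintro p (rfl | rfl | hp) q (rfl | rfl | hq) hne
    exacts [absurd rfl hne, h, hρT hq, h', absurd rfl hne, hσT hq,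
      hcomm hρ (hT p hp) (hρT hp), hcomm hσ (hT p hp) (hσT hp), hTorth p hp q hq hne]
  · rw [Finset.sum_insert hρn, Finset.sum_insert hσn, hTsum]
    abel

/-- A weakly antidistinguishable set of pure states is contextual. -/
theorem IsWA.isContextualSet {d : ℕ} {S : Finset (Mat d)} (hpure : ∀ ρ ∈ S, IsPureState ρ)
    (hWA : IsWA S) : IsContextualSet S := by
  classical
  obtain ⟨P, hP, hPS⟩ := hWA
  obtain ⟨C, hC, hCP⟩ := hP.exists_context
  have hex (σ : Mat d) (hσ : σ ∈ C) : ∃ ρ ∈ S, ρ * σ = 0 := by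
    obtain ⟨p, hp, hσp⟩ := hCP σ hσ
    obtain ⟨ρ, hρ, htr⟩ := hPS p hp
    have hpρ := (hP.1 p hp).mul_eq_zero_of_trace (hpure ρ hρ).isProjection htr
    refine ⟨ρ, hρ, (hC.1 σ hσ).isProjection.mul_eq_zero_comm (hpure ρ hρ).isProjection ?_⟩
    rw [← hσp, mul_assoc, hpρ, mul_zero]
  choose! ρ hρS hρσ using hex
  have hctx (σ : Mat d) (hσ : σ ∈ C) : ∃ D : Finset (Mat d), IsContext D ∧ ρ σ ∈ D ∧ σ ∈ D :=
    (hpure _ (hρS σ hσ)).exists_context (hC.1 σ hσ) (hρσ σ hσ)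
  choose! D hD hρD hσD using hctx
  refine ⟨S ∪ C.biUnion D, ⟨?_, Finset.subset_union_left, ?_⟩, ?_⟩
  · intro τ hτ
    rcases Finset.mem_union.1 hτ with hτ | hτ
    · exact hpure τ hτ
    · obtain ⟨σ, hσ, hτ⟩ := Finset.mem_biUnion.1 hτ
      exact (hD σ hσ).1 τ hτ
  · intro τ hτ hτS
    obtain ⟨σ, hσ, hτ⟩ := Finset.mem_biUnion.1 ((Finset.mem_union.1 hτ).resolve_left hτS)
    refine ⟨(hD σ hσ).1 τ hτ, ρ σ, hρS σ hσ, (hD σ hσ).2.1 _ (hρD σ hσ) τ hτ ?_⟩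
    rintro rfl
    exact hτS (hρS σ hσ)
  · rintro ⟨ν, ⟨-, hν⟩, hνS⟩
    have hsub (σ : Mat d) (hσ : σ ∈ C) : D σ ⊆ S ∪ C.biUnion D :=
      (Finset.subset_biUnion_of_mem D hσ).trans Finset.subset_union_right
    have hzero (σ : Mat d) (hσ : σ ∈ C) : ν σ = 0 := by
      have hne : σ ≠ ρ σ := fun h => (hC.1 σ hσ).mul_self_ne_zero <| by
        nth_rewrite 1 [h]
        exact hρσ σ hσ
      have hone := hν (D σ) (hsub σ hσ) (hD σ hσ)
      rw [← Finset.add_sum_erase _ _ (hρD σ hσ), hνS _ (hρS σ hσ)] at hone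
      have hle := Finset.single_le_sum (f := ν) (fun _ _ => Nat.zero_le _)
        (Finset.mem_erase.2 ⟨hne, hσD σ hσ⟩)
      omega
    have hCX : C ⊆ S ∪ C.biUnion D := fun σ hσ => hsub σ hσ (hσD σ hσ)
    have := hν C hCX hC
    rw [Finset.sum_eq_zero hzero] at this
    exact zero_ne_one this

/-- A non-orthogonal contextual set of pure states is weakly antidistinguishable. -/
theorem IsContextualSet.isWA {d : ℕ} {S : Finset (Mat d)} (hnon : NonOrthogonal S)
    (hS : IsContextualSet S) : IsWA S := by
  classical
  obtain ⟨X, ⟨-, -, himp⟩, hinst⟩ := hS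
  by_contra hWA
  refine hinst ⟨fun σ => if σ ∈ S then 1 else 0, ⟨fun σ _ => ?_, fun C hCX hC => ?_⟩,
    fun ρ hρ => if_pos hρ⟩
  · dsimp only
    split_ifs <;> simp
  · obtain ⟨ρ, hρC, hρS⟩ : ∃ ρ ∈ C, ρ ∈ S := by
      by_contra! hdisj
      refine hWA ⟨C, ⟨fun p hp => (hC.1 p hp).isProjection, hC.2.1, hC.2.2⟩, fun σ hσ => ?_⟩
      obtain ⟨-, ρ, hρ, h⟩ := himp σ (hCX hσ) (hdisj σ hσ)
      exact ⟨ρ, hρ, by rw [trace_mul_comm, h, trace_zero]⟩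
    rw [Finset.sum_eq_single_of_mem ρ hρC, if_pos hρS]
    intro σ hσ hne
    refine if_neg fun hσS => hnon σ hσS ρ hρS hne ?_
    rw [hC.2.1 σ hσ ρ hρC hne, trace_zero]

/-- A finite non-orthogonal set of pure states is weakly
antidistinguishable if and only if it is contextual. -/
theorem statement_0 {d : ℕ} (S : Finset (Mat d))
    (hpure : ∀ ρ ∈ S, IsPureState ρ) (hnon : NonOrthogonal S) :
    IsWA S ↔ IsContextualSet S :=
  ⟨IsWA.isContextualSet hpure, IsContextualSet.isWA hnon⟩
end

section
/- A finite non-orthogonal set of pure states on a finite-dimensional complex Hilbert space that is maximally contextual is antidistinguishable. -/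
open Matrix

theorem sum_mul_sum_eq_sum_inter {d : ℕ} [DecidableEq (Mat d)] {C A B : Finset (Mat d)}
    (hC : IsContext C) (hA : A ⊆ C) (hB : B ⊆ C) :
    (∑ p ∈ A, p) * ∑ q ∈ B, q = ∑ p ∈ A ∩ B, p := by
  rw [Finset.sum_mul_sum, ← Finset.filter_mem_eq_inter, Finset.sum_filter]
  refine Finset.sum_congr rfl fun p hp => ?_
  have hmul : ∀ q ∈ B, p * q = if p = q then p else 0 := fun q hq => by
    split_ifs with h
    · rw [← h, ((hC.1 p (hA hp)).isProjection).2]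
    · exact hC.2.1 p (hA hp) q (hB hq) h
  rw [Finset.sum_congr rfl hmul, Finset.sum_ite_eq]

/-- A context each of whose elements is orthogonal to some state of `S` yields, by coarse-graining,
a measurement antidistinguishing `S`. -/
theorem IsContext.isA {d : ℕ} {S C : Finset (Mat d)} (hC : IsContext C)
    (h : ∀ p ∈ C, ∃ ρ ∈ S, ρ * p = 0) : IsA S := by
  classical
  choose! f hfS hf using h
  refine ⟨fun ρ => ∑ p ∈ C with f p = ρ, p, fun ρ _ => ⟨?_, ?_⟩, fun ρ _ ρ' _ hne => ?_, ?_,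
    fun ρ _ => ?_⟩
  · rw [IsHermitian, conjTranspose_sum]
    exact Finset.sum_congr rfl fun p hp =>
      (hC.1 p (Finset.mem_of_mem_filter p hp)).isProjection.1
  · rw [sum_mul_sum_eq_sum_inter hC (Finset.filter_subset _ _) (Finset.filter_subset _ _),
      Finset.inter_self]
  · rw [sum_mul_sum_eq_sum_inter hC (Finset.filter_subset _ _) (Finset.filter_subset _ _)]
    convert Finset.sum_empty
    ext p
    simp only [Finset.mem_inter, Finset.mem_filter, Finset.notMem_empty, iff_false]
    rintro ⟨⟨-, h₁⟩, -, h₂⟩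
    exact hne (h₁.symm.trans h₂)
  · rw [Finset.sum_fiberwise_of_maps_to hfS, hC.2.2]
  · rw [trace_mul_comm, Finset.mul_sum, Finset.sum_eq_zero, trace_zero]
    intro p hp
    obtain ⟨hpC, rfl⟩ := Finset.mem_filter.1 hp
    exact hf p hpC

/-- A non-orthogonal contextual set is antidistinguishable. -/
theorem IsContextualSet.isA {d : ℕ} {S : Finset (Mat d)} (h : IsContextualSet S)
    (hnon : NonOrthogonal S) : IsA S := by
  classical
  obtain ⟨X, ⟨-, -, hX⟩, hctx⟩ := h
  by_contra hA
  refine hctx ⟨fun σ => if σ ∈ S then 1 else 0, ⟨fun σ _ => ?_, fun C hCX hC => ?_⟩,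
    fun ρ hρ => if_pos hρ⟩
  · by_cases hσ : σ ∈ S <;> simp [hσ]
  · obtain ⟨p, hpC, hpS⟩ : ∃ p ∈ C, p ∈ S := by
      by_contra! hdisj
      exact hA (hC.isA fun p hp => (hX p (hCX hp) (hdisj p hp)).2)
    rw [Finset.sum_eq_single_of_mem p hpC, if_pos hpS]
    intro q hqC hqp
    refine if_neg fun hqS => hnon q hqS p hpS hqp ?_
    rw [hC.2.1 q hqC p hpC hqp, trace_zero]

/-- A finite non-orthogonal set of pure states that is maximally
contextual is antidistinguishable. -/
theorem statement_3 {d : ℕ} (S : Finset (Mat d))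
    (hpure : ∀ ρ ∈ S, IsPureState ρ) (hnon : NonOrthogonal S)
    (hmax : MaximallyContextual S) :
    IsA S :=
  hmax.1.isA hnon
end

section
/- A set of two non-orthogonal pure states on a finite-dimensional complex Hilbert space is not weakly antidistinguishable. -/
open Matrix

/-- A set of two non-orthogonal pure states is not weakly
antidistinguishable. -/
theorem statement_6 {d : ℕ} (ρ₁ ρ₂ : Mat d)
    (h1 : IsPureState ρ₁) (h2 : IsPureState ρ₂) (hne : ρ₁ ≠ ρ₂)
    (hnon : (ρ₁ * ρ₂).trace ≠ 0) :
    ¬ IsWA ({ρ₁, ρ₂} : Finset (Mat d)) := by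
  rintro ⟨P, ⟨hP, -, hsum⟩, hWA⟩
  apply hnon
  rw [← Matrix.one_mul (ρ₁ * ρ₂), ← hsum, Finset.sum_mul, trace_sum]
  refine Finset.sum_eq_zero fun p hp => ?_
  obtain ⟨ρ, hρ, htr⟩ := hWA p hp
  simp only [Finset.mem_insert, Finset.mem_singleton] at hρ
  rcases hρ with rfl | rfl
  · rw [← Matrix.mul_assoc, (hP p hp).mul_eq_zero_of_trace h1.isProjection htr,
      Matrix.zero_mul, trace_zero]
  · rw [trace_mul_comm, Matrix.mul_assoc,
      h2.isProjection.mul_eq_zero_of_trace (hP p hp) (by rwa [trace_mul_comm]),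
      Matrix.mul_zero, trace_zero]
end

section
/- The four PBR states |0⟩⊗|0⟩, |0⟩⊗|+⟩, |+⟩⊗|0⟩, |+⟩⊗|+⟩ in ℂ²⊗ℂ² ≅ ℂ⁴ are strongly antidistinguishable, with strongly antidistinguishing PVM given by the rank-1 projections onto the orthonormal basis ξ_1 = (|01⟩+|10⟩)/√2, ξ_2 = (|0−⟩+|1+⟩)/√2, ξ_3 = (|+1⟩+|−0⟩)/√2, ξ_4 = (|+−⟩+|−+⟩)/√2; in particular, each projector |ξ_i⟩⟨ξ_i| annihilates the i-th PBR state and has nonzero overlap with every other PBR state. -/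
open Matrix

/-- `√2` as a complex scalar. -/
noncomputable def sqrt2 : ℂ := Real.sqrt 2

/-- The four PBR state vectors `|00⟩, |0+⟩, |+0⟩, |++⟩` in `ℂ² ⊗ ℂ² ≅ ℂ⁴`
(coordinates in the basis order `00, 01, 10, 11`). -/
noncomputable def pbrVec : Fin 4 → (Fin 4 → ℂ)
  | 0 => ![1, 0, 0, 0]
  | 1 => sqrt2⁻¹ • ![1, 1, 0, 0]
  | 2 => sqrt2⁻¹ • ![1, 0, 1, 0]
  | 3 => (2 : ℂ)⁻¹ • ![1, 1, 1, 1]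

/-- The four PBR pure states. -/
noncomputable def pbrState (i : Fin 4) : Mat 4 :=
  vecMulVec (pbrVec i) (star (pbrVec i))

/-- The PBR measurement basis
`ξ₁ = (|01⟩+|10⟩)/√2`, `ξ₂ = (|0−⟩+|1+⟩)/√2`, `ξ₃ = (|+1⟩+|−0⟩)/√2`,
`ξ₄ = (|+−⟩+|−+⟩)/√2` written in coordinates in the basis order `00, 01, 10, 11`. -/
noncomputable def xiVec : Fin 4 → (Fin 4 → ℂ)
  | 0 => sqrt2⁻¹ • ![0, 1, 1, 0]
  | 1 => (2 : ℂ)⁻¹ • ![1, -1, 1, 1]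
  | 2 => (2 : ℂ)⁻¹ • ![1, 1, -1, 1]
  | 3 => sqrt2⁻¹ • ![1, 0, 0, -1]

/-- The rank-1 projections onto the PBR measurement basis. -/
noncomputable def xiProj (i : Fin 4) : Mat 4 :=
  vecMulVec (xiVec i) (star (xiVec i))

theorem sqrt2_inv_mul_self : sqrt2⁻¹ * sqrt2⁻¹ = (2 : ℂ)⁻¹ := by
  rw [← mul_inv, sqrt2, ← Complex.ofReal_mul, Real.mul_self_sqrt zero_le_two, Complex.ofReal_ofNat]

theorem sqrt2_ne_zero : sqrt2 ≠ 0 := by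
  simp [sqrt2]

theorem conj_sqrt2 : (starRingEnd ℂ) sqrt2 = sqrt2 :=
  Complex.conj_ofReal _

/-- The trace of a product of two rank-1 operators `|u⟩⟨u|` and `|v⟩⟨v|` is `⟨u|v⟩⟨v|u⟩`. -/
theorem trace_vecMulVec_star_mul_vecMulVec_star {d : ℕ} (u v : Fin d → ℂ) :
    (vecMulVec u (star u) * vecMulVec v (star v)).trace = (star u ⬝ᵥ v) * star (star u ⬝ᵥ v) := by
  rw [vecMulVec_mul_vecMulVec, trace_vecMulVec, dotProduct_smul, smul_eq_mul, dotProduct_comm u,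
    star_dotProduct v u]

theorem star_xiVec (i : Fin 4) : star (xiVec i) = xiVec i := by
  ext a
  fin_cases i <;> fin_cases a <;>
    simp only [xiVec, Pi.star_apply, Pi.smul_apply, smul_eq_mul] <;>
    simp [conj_sqrt2]

theorem star_xiVec_dotProduct_xiVec (i j : Fin 4) :
    star (xiVec i) ⬝ᵥ xiVec j = if i = j then 1 else 0 := by
  have h := sqrt2_inv_mul_self
  rw [star_xiVec]
  fin_cases i <;> fin_cases j <;> simp [xiVec, dotProduct, Fin.sum_univ_four] <;> grind

theorem isPVMFam_xiProj : IsPVMFam xiProj := by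
  have mul_eq (i j : Fin 4) :
      xiProj i * xiProj j = if i = j then xiProj i else 0 := by
    rw [xiProj, xiProj, vecMulVec_mul_vecMulVec, star_xiVec_dotProduct_xiVec]
    split_ifs with hij
    · rw [hij, one_smul]
    · rw [zero_smul, vecMulVec_zero]
  refine ⟨fun i => ⟨?_, ?_⟩, fun i j hij => ?_, ?_⟩
  · rw [xiProj, IsHermitian, conjTranspose_vecMulVec, star_star]
  · rw [mul_eq, if_pos rfl]
  · rw [mul_eq, if_neg hij]
  · have h := sqrt2_inv_mul_self
    ext a b
    simp only [xiProj, Fin.sum_univ_four, Matrix.add_apply, vecMulVec_apply, xiVec]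
    fin_cases a <;> fin_cases b <;> simp [conj_sqrt2] <;> grind

/-- The `i`-th basis vector is orthogonal to the `j`-th PBR state exactly when `i = j`. -/
theorem star_xiVec_dotProduct_pbrVec_eq_zero_iff (i j : Fin 4) :
    star (xiVec i) ⬝ᵥ pbrVec j = 0 ↔ j = i := by
  have h := sqrt2_ne_zero
  rw [star_xiVec]
  fin_cases i <;> fin_cases j <;> simp [xiVec, pbrVec, dotProduct, Fin.sum_univ_four] <;> grind

theorem trace_xiProj_mul_pbrState_eq_zero_iff (i j : Fin 4) :
    (xiProj i * pbrState j).trace = 0 ↔ j = i := by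
  rw [xiProj, pbrState, trace_vecMulVec_star_mul_vecMulVec_star, mul_eq_zero, star_eq_zero,
    or_self, star_xiVec_dotProduct_pbrVec_eq_zero_iff]

/-- The four PBR states are strongly antidistinguishable by the PVM of
rank-1 projections onto `ξ₁, ξ₂, ξ₃, ξ₄`: this family is a PVM, it weakly
antidistinguishes the PBR states, and each `|ξ_i⟩⟨ξ_i|` annihilates the `i`-th PBR state
while having nonzero overlap with every other PBR state. -/
theorem statement_10 :
    IsPVMFam xiProj ∧
    (∀ j : Fin 4, ∃ i : Fin 4, (xiProj j * pbrState i).trace = 0) ∧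
    ∀ i : Fin 4, (xiProj i * pbrState i).trace = 0 ∧
      ∀ j : Fin 4, j ≠ i → (xiProj i * pbrState j).trace ≠ 0 := by
  refine ⟨isPVMFam_xiProj, fun j => ⟨j, ?_⟩, fun i => ⟨?_, fun j hj => ?_⟩⟩
  · exact (trace_xiProj_mul_pbrState_eq_zero_iff j j).2 rfl
  · exact (trace_xiProj_mul_pbrState_eq_zero_iff i i).2 rfl
  · exact mt (trace_xiProj_mul_pbrState_eq_zero_iff i j).1 hj
end

section
/- No three-element subset of the four PBR states |0⟩⊗|0⟩, |0⟩⊗|+⟩, |+⟩⊗|0⟩, |+⟩⊗|+⟩ in ℂ⁴ is antidistinguishable. -/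
open Matrix

open scoped ComplexOrder in
theorem IsProjection.posSemidef {d : ℕ} {p : Mat d} (hp : IsProjection p) : p.PosSemidef := by
  rw [← hp.2]
  nth_rewrite 1 [← hp.1.eq]
  exact posSemidef_conjTranspose_mul_self p

theorem trace_mul_vecMulVec_star {d : ℕ} (p : Mat d) (v : Fin d → ℂ) :
    (p * vecMulVec v (star v)).trace = star v ⬝ᵥ p *ᵥ v := by
  rw [mul_vecMulVec, trace_vecMulVec, dotProduct_comm]

open scoped ComplexOrder in
theorem IsProjection.mulVec_eq_zero_of_trace {d : ℕ} {p : Mat d} (hp : IsProjection p)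
    {v : Fin d → ℂ} (h : (p * vecMulVec v (star v)).trace = 0) : p *ᵥ v = 0 := by
  rw [trace_mul_vecMulVec_star] at h
  exact (hp.posSemidef.dotProduct_mulVec_zero_iff v).1 h

theorem Matrix.IsHermitian.star_vecMul_eq_zero {d : ℕ} {p : Mat d} (hp : p.IsHermitian)
    {v : Fin d → ℂ} (h : p *ᵥ v = 0) : star v ᵥ* p = 0 := by
  rw [← hp.eq, ← star_mulVec, h, star_zero]

open scoped ComplexOrder in
/-- If the three outcomes of a PVM exclude `a`, `b` and `c` respectively, the pairwise overlaps
of these vectors are bounded by their norms. -/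
theorem IsPVMFam.re_overlaps_le {d : ℕ} {π : Fin 3 → Mat d} (hπ : IsPVMFam π)
    {a b c : Fin d → ℂ} (ha : π 0 *ᵥ a = 0) (hb : π 1 *ᵥ b = 0) (hc : π 2 *ᵥ c = 0) :
    (star a ⬝ᵥ b + star b ⬝ᵥ a + star a ⬝ᵥ c + star c ⬝ᵥ a + star b ⬝ᵥ c + star c ⬝ᵥ b).re ≤
      (star a ⬝ᵥ a + star b ⬝ᵥ b + star c ⬝ᵥ c).re := by
  obtain ⟨hproj, -, hsum⟩ := hπ
  have ha' := (hproj 0).1.star_vecMul_eq_zero ha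
  have hb' := (hproj 1).1.star_vecMul_eq_zero hb
  have hc' := (hproj 2).1.star_vecMul_eq_zero hc
  have resolve (x y : Fin d → ℂ) : star x ⬝ᵥ y =
      star x ⬝ᵥ π 0 *ᵥ y + star x ⬝ᵥ π 1 *ᵥ y + star x ⬝ᵥ π 2 *ᵥ y := by
    rw [← dotProduct_add, ← dotProduct_add, ← add_mulVec, ← add_mulVec, ← Fin.sum_univ_three,
      hsum, one_mulVec]
  have left_zero {p : Mat d} {x : Fin d → ℂ} (h : star x ᵥ* p = 0) (y : Fin d → ℂ) :
      star x ⬝ᵥ p *ᵥ y = 0 := by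
    rw [dotProduct_mulVec, h, zero_dotProduct]
  have h0 := (hproj 0).posSemidef.re_dotProduct_nonneg (b - c)
  have h1 := (hproj 1).posSemidef.re_dotProduct_nonneg (a - c)
  have h2 := (hproj 2).posSemidef.re_dotProduct_nonneg (a - b)
  simp only [star_sub, mulVec_sub, dotProduct_sub, sub_dotProduct, map_sub,
    RCLike.re_to_complex] at h0 h1 h2
  rw [resolve a a, resolve a b, resolve a c, resolve b a, resolve b b, resolve b c,
    resolve c a, resolve c b, resolve c c]
  simp only [ha, hb, hc, left_zero ha', left_zero hb', left_zero hc', dotProduct_zero,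
    Complex.add_re, Complex.zero_re]
  linarith

theorem sqrt2_inv_eq_ofReal : sqrt2⁻¹ = ((√2)⁻¹ : ℝ) := by
  simp [sqrt2]

theorem re_star_dotProduct_pbrVec_self (i : Fin 4) : (star (pbrVec i) ⬝ᵥ pbrVec i).re = 1 := by
  have hs : (√2)⁻¹ * (√2)⁻¹ = (1 / 2 : ℝ) := by
    rw [← mul_inv, Real.mul_self_sqrt (by norm_num)]; norm_num
  fin_cases i <;>
    simp [pbrVec, sqrt2_inv_eq_ofReal, dotProduct, Fin.sum_univ_four, -Complex.ofReal_inv, hs] <;>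
    norm_num

theorem half_le_re_star_dotProduct_pbrVec (i j : Fin 4) :
    1 / 2 ≤ (star (pbrVec i) ⬝ᵥ pbrVec j).re := by
  have hs : (√2)⁻¹ * (√2)⁻¹ = (1 / 2 : ℝ) := by
    rw [← mul_inv, Real.mul_self_sqrt (by norm_num)]; norm_num
  have hpos : 0 < (√2)⁻¹ := by positivity
  have hle : 1 / 2 ≤ (√2)⁻¹ := by nlinarith
  fin_cases i <;> fin_cases j <;>
    simp [pbrVec, sqrt2_inv_eq_ofReal, dotProduct, Fin.sum_univ_four, -Complex.ofReal_inv, hs] <;>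
    linarith

theorem half_lt_re_star_dotProduct_pbrVec {i j : Fin 4} (hij : j ≠ i.rev) :
    1 / 2 < (star (pbrVec i) ⬝ᵥ pbrVec j).re := by
  have hs : (√2)⁻¹ * (√2)⁻¹ = (1 / 2 : ℝ) := by
    rw [← mul_inv, Real.mul_self_sqrt (by norm_num)]; norm_num
  have hpos : 0 < (√2)⁻¹ := by positivity
  have hlt : 1 / 2 < (√2)⁻¹ := by nlinarith
  fin_cases i <;> fin_cases j <;> first
    | exact absurd rfl hij
    | simp [pbrVec, sqrt2_inv_eq_ofReal, dotProduct, Fin.sum_univ_four, -Complex.ofReal_inv, hs] <;>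
        linarith

/-- No three-element subset of the four PBR states is
antidistinguishable. -/
theorem statement_12 :
    ∀ i j k : Fin 4, i ≠ j → i ≠ k → j ≠ k →
      ¬ ∃ π : Fin 3 → Mat 4, IsPVMFam π ∧
          (π 0 * pbrState i).trace = 0 ∧
          (π 1 * pbrState j).trace = 0 ∧
          (π 2 * pbrState k).trace = 0 := by
  rintro i j k - - hjk ⟨π, hπ, hi, hj, hk⟩
  have h := hπ.re_overlaps_le ((hπ.1 0).mulVec_eq_zero_of_trace hi)
    ((hπ.1 1).mulVec_eq_zero_of_trace hj) ((hπ.1 2).mulVec_eq_zero_of_trace hk)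
  simp only [Complex.add_re, re_star_dotProduct_pbrVec_self] at h
  have hij := half_le_re_star_dotProduct_pbrVec i j
  have hji := half_le_re_star_dotProduct_pbrVec j i
  have hik := half_le_re_star_dotProduct_pbrVec i k
  have hki := half_le_re_star_dotProduct_pbrVec k i
  have hjk' := half_le_re_star_dotProduct_pbrVec j k
  have hkj := half_le_re_star_dotProduct_pbrVec k j
  by_cases hrev : j = i.rev
  · linarith [half_lt_re_star_dotProduct_pbrVec (fun hk => hjk (hrev.trans hk.symm) : k ≠ i.rev)]
  · linarith [half_lt_re_star_dotProduct_pbrVec hrev]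
end

section
/- The set of four PBR states |0⟩⊗|0⟩, |0⟩⊗|+⟩, |+⟩⊗|0⟩, |+⟩⊗|+⟩ in ℂ⁴ is maximally contextual: it is contextual, and no proper subset of it is contextual. -/
open Matrix

/-- Integer vectors as complex vectors. -/
def intVec {d : ℕ} (u : Fin d → ℤ) : Fin d → ℂ := fun i => u i

theorem star_intVec {d : ℕ} (u : Fin d → ℤ) : star (intVec u) = intVec u := by
  ext i; simp [intVec]

theorem intVec_dotProduct {d : ℕ} (u v : Fin d → ℤ) :
    intVec u ⬝ᵥ intVec v = ((u ⬝ᵥ v : ℤ) : ℂ) := by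
  simp [intVec, dotProduct]

/-- The orthogonal projection onto the ray spanned by an integer vector. -/
noncomputable def rayProj {d : ℕ} (u : Fin d → ℤ) : Mat d :=
  ((u ⬝ᵥ u : ℤ) : ℂ)⁻¹ • vecMulVec (intVec u) (intVec u)

theorem conjTranspose_rayProj {d : ℕ} (u : Fin d → ℤ) : (rayProj u)ᴴ = rayProj u := by
  rw [rayProj, conjTranspose_smul, conjTranspose_vecMulVec, star_intVec]
  simp

theorem rayProj_mulVec {d : ℕ} (u v : Fin d → ℤ) :
    rayProj u *ᵥ intVec v = (((u ⬝ᵥ u : ℤ) : ℂ)⁻¹ * ((u ⬝ᵥ v : ℤ) : ℂ)) • intVec u := by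
  rw [rayProj, smul_mulVec, vecMulVec_mulVec, intVec_dotProduct, op_smul_eq_smul, smul_smul]

theorem rayProj_mulVec_self {d : ℕ} {u : Fin d → ℤ} (hu : u ⬝ᵥ u ≠ 0) :
    rayProj u *ᵥ intVec u = intVec u := by
  rw [rayProj_mulVec, inv_mul_cancel₀ (Int.cast_ne_zero.mpr hu), one_smul]

theorem intVec_ne_zero {d : ℕ} {u : Fin d → ℤ} (hu : u ⬝ᵥ u ≠ 0) : intVec u ≠ 0 := by
  intro h
  have := intVec_dotProduct u u
  rw [h, zero_dotProduct] at this
  exact hu (by exact_mod_cast this.symm)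

theorem rayProj_mul_eq_zero {d : ℕ} {u v : Fin d → ℤ} (h : u ⬝ᵥ v = 0) :
    rayProj u * rayProj v = 0 := by
  rw [rayProj, rayProj, smul_mul_smul_comm, vecMulVec_mul_vecMulVec, intVec_dotProduct, h]
  simp

theorem rayProj_mul_ne_zero {d : ℕ} {u v : Fin d → ℤ} (hu : u ⬝ᵥ u ≠ 0) (hv : v ⬝ᵥ v ≠ 0)
    (h : u ⬝ᵥ v ≠ 0) : rayProj u * rayProj v ≠ 0 := by
  intro h0
  have h1 : (rayProj u * rayProj v) *ᵥ intVec v = 0 := by rw [h0, zero_mulVec]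
  rw [← mulVec_mulVec, rayProj_mulVec_self hv, rayProj_mulVec] at h1
  refine smul_ne_zero (mul_ne_zero (inv_ne_zero ?_) ?_) (intVec_ne_zero hu) h1
  · exact_mod_cast hu
  · exact_mod_cast h

theorem isPureState_rayProj {d : ℕ} {u : Fin d → ℤ} (hu : u ⬝ᵥ u ≠ 0) :
    IsPureState (rayProj u) := by
  have hpos : (0 : ℝ) ≤ ((u ⬝ᵥ u : ℤ) : ℝ) :=
    Int.cast_nonneg (Finset.sum_nonneg fun i _ => mul_self_nonneg (u i))
  set r : ℝ := √((u ⬝ᵥ u : ℤ) : ℝ)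
  have hr : (r : ℂ) * r = ((u ⬝ᵥ u : ℤ) : ℂ) := by
    rw [← Complex.ofReal_mul, Real.mul_self_sqrt hpos, Complex.ofReal_intCast]
  have hinv : (r : ℂ)⁻¹ * (r : ℂ)⁻¹ = ((u ⬝ᵥ u : ℤ) : ℂ)⁻¹ := by rw [← mul_inv, hr]
  have hstar : star ((r : ℂ)⁻¹ • intVec u) = (r : ℂ)⁻¹ • intVec u := by
    rw [star_smul, star_intVec, star_inv₀, Complex.star_def, Complex.conj_ofReal]
  refine ⟨(r : ℂ)⁻¹ • intVec u, ?_, ?_⟩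
  · rw [hstar, smul_dotProduct, dotProduct_smul, smul_smul, hinv, intVec_dotProduct, smul_eq_mul,
      inv_mul_cancel₀ (Int.cast_ne_zero.mpr hu)]
  · rw [hstar, smul_vecMulVec, vecMulVec_smul, smul_smul, hinv, rayProj]

/-- A full family of pairwise orthogonal nonzero integer vectors. -/
def IsOrthogonalFamily {d : ℕ} (U : Fin d → Fin d → ℤ) : Prop :=
  ∀ i j, U i ⬝ᵥ U j = 0 ↔ i ≠ j

namespace IsOrthogonalFamily

variable {d : ℕ} {U : Fin d → Fin d → ℤ}

theorem self_ne_zero (hU : IsOrthogonalFamily U) (i : Fin d) : U i ⬝ᵥ U i ≠ 0 :=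
  fun h => (hU i i).mp h rfl

theorem rayProj_injective (hU : IsOrthogonalFamily U) :
    Function.Injective fun k => rayProj (U k) := by
  intro i j h
  by_contra hij
  have h0 : rayProj (U i) * rayProj (U j) = 0 := rayProj_mul_eq_zero ((hU i j).mpr hij)
  rw [← show rayProj (U i) = rayProj (U j) from h] at h0
  exact rayProj_mul_ne_zero (hU.self_ne_zero i) (hU.self_ne_zero i) (hU.self_ne_zero i) h0

theorem sum_rayProj (hU : IsOrthogonalFamily U) : ∑ k, rayProj (U k) = 1 := by
  let A : Mat d := of fun i k => (U k i : ℂ)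
  let D : Mat d := diagonal fun k => ((U k ⬝ᵥ U k : ℤ) : ℂ)⁻¹
  have h1 : D * Aᵀ * A = 1 := by
    ext i j
    have hA : (Aᵀ * A) i j = ((U i ⬝ᵥ U j : ℤ) : ℂ) := by
      simp [A, mul_apply, dotProduct]
    rw [Matrix.mul_assoc, diagonal_mul, hA]
    rcases eq_or_ne i j with rfl | hij
    · rw [one_apply_eq, inv_mul_cancel₀ (Int.cast_ne_zero.mpr (hU.self_ne_zero i))]
    · rw [one_apply_ne hij, (hU i j).mpr hij, Int.cast_zero, mul_zero]
  rw [← mul_eq_one_comm.mp h1]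
  ext i j
  simp only [Matrix.sum_apply, mul_apply (M := A), D, diagonal_mul]
  refine Finset.sum_congr rfl fun k _ => ?_
  simp [A, rayProj, intVec, vecMulVec_apply]
  ring

theorem isContext (hU : IsOrthogonalFamily U) :
    IsContext (Finset.univ.image fun k => rayProj (U k)) := by
  refine ⟨?_, ?_, ?_⟩
  · simp only [Finset.mem_image, Finset.mem_univ, true_and, forall_exists_index,
      forall_apply_eq_imp_iff]
    exact fun k => isPureState_rayProj (hU.self_ne_zero k)
  · simp only [Finset.mem_image, Finset.mem_univ, true_and, forall_exists_index,
      forall_apply_eq_imp_iff]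
    intro i j hij
    exact rayProj_mul_eq_zero ((hU i j).mpr fun h => hij (by rw [h]))
  · rw [Finset.sum_image hU.rayProj_injective.injOn, hU.sum_rayProj]

theorem sum_assignment (hU : IsOrthogonalFamily U) {X : Finset (Mat d)} {ν : Mat d → ℕ}
    (hν : NoncontextualAssignment X ν) (hX : ∀ k, rayProj (U k) ∈ X) :
    ∑ k, ν (rayProj (U k)) = 1 := by
  rw [← hν.2 _ (by simpa [Finset.image_subset_iff] using hX) hU.isContext,
    Finset.sum_image hU.rayProj_injective.injOn]

theorem assignment_eq_zero (hU : IsOrthogonalFamily U) {X : Finset (Mat d)} {ν : Mat d → ℕ}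
    (hν : NoncontextualAssignment X ν) (hX : ∀ k, rayProj (U k) ∈ X) {i j : Fin d} (hij : i ≠ j)
    (hi : ν (rayProj (U i)) = 1) : ν (rayProj (U j)) = 0 := by
  have hsum := hU.sum_assignment hν hX
  rw [← Finset.add_sum_erase _ _ (Finset.mem_univ i), hi] at hsum
  have h0 : ∑ k ∈ Finset.univ.erase i, ν (rayProj (U k)) = 0 := by omega
  exact Finset.sum_eq_zero_iff.mp h0 j (Finset.mem_erase.mpr ⟨hij.symm, Finset.mem_univ j⟩)

end IsOrthogonalFamily

/-- A set of pairwise non-orthogonal states is noncontextual as soon as every context has an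
element that is orthogonal to none of the states. -/
theorem not_isContextualSet {d : ℕ} {S : Finset (Mat d)}
    (hS : ∀ ρ ∈ S, ∀ ρ' ∈ S, ρ * ρ' ≠ 0)
    (hC : ∀ C : Finset (Mat d), IsContext C → ∃ p ∈ C, ∀ ρ ∈ S, ρ * p ≠ 0) :
    ¬ IsContextualSet S := by
  classical
  rintro ⟨X, ⟨-, -, hXS⟩, hinst⟩
  refine hinst ⟨fun σ => if σ ∈ S then 1 else 0, ⟨fun σ _ => ?_, fun C hCX hctx => ?_⟩,
    fun ρ hρ => if_pos hρ⟩
  · by_cases h : σ ∈ S <;> simp [h]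
  · obtain ⟨p, hp, hpS⟩ := hC C hctx
    have hmem : p ∈ S := by
      by_contra h
      obtain ⟨-, ρ, hρ, h0⟩ := hXS p (hCX hp) h
      exact hpS ρ hρ h0
    rw [Finset.sum_eq_single_of_mem p hp, if_pos hmem]
    intro q hq hqp
    exact if_neg fun hqS => hS q hqS p hmem (hctx.2.1 q hq p hp hqp)

/-- For a pure state `p`, the quadratic form `⟨x|p|x⟩` is `‖⟨φ|x⟩‖ ^ 2`. -/
theorem dotProduct_vecMulVec_mulVec {d : ℕ} (φ x : Fin d → ℂ) :
    star x ⬝ᵥ (vecMulVec φ (star φ) *ᵥ x) = ((‖star φ ⬝ᵥ x‖ ^ 2 : ℝ) : ℂ) := by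
  have h : star x ⬝ᵥ φ = star (star φ ⬝ᵥ x) := star_dotProduct x φ
  rw [vecMulVec_mulVec, op_smul_eq_smul, dotProduct_smul, h, smul_eq_mul, Complex.star_def,
    Complex.mul_conj, Complex.normSq_eq_norm_sq]

theorem IsContext.sum_quadraticForm {d : ℕ} {C : Finset (Mat d)} (hC : IsContext C)
    (x : Fin d → ℂ) : ∑ p ∈ C, (star x ⬝ᵥ (p *ᵥ x)).re = (star x ⬝ᵥ x).re := by
  rw [← Complex.re_sum, ← dotProduct_sum, ← sum_mulVec, hC.2.2, one_mulVec]

/-- If every element of a context annihilates one of the vectors `v j`, `j ∈ T`, then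
`‖∑ v j‖ ^ 2 ≤ (|T| - 1) * ∑ ‖v j‖ ^ 2`. -/
theorem IsContext.norm_sum_le {d : ℕ} {ι : Type*} {C : Finset (Mat d)} (hC : IsContext C)
    (T : Finset ι) (v : ι → Fin d → ℂ) (h : ∀ p ∈ C, ∃ j ∈ T, p *ᵥ v j = 0) :
    (star (∑ j ∈ T, v j) ⬝ᵥ ∑ j ∈ T, v j).re ≤ (T.card - 1) * ∑ j ∈ T, (star (v j) ⬝ᵥ v j).re := by
  classical
  simp_rw [← hC.sum_quadraticForm]
  rw [Finset.sum_comm, Finset.mul_sum]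
  refine Finset.sum_le_sum fun p hp => ?_
  obtain ⟨j, hj, hpj⟩ := h p hp
  obtain ⟨φ, hφ, rfl⟩ := hC.1 p hp
  simp_rw [dotProduct_vecMulVec_mulVec, Complex.ofReal_re, dotProduct_sum]
  have h0 : star φ ⬝ᵥ v j = 0 := by
    have := dotProduct_vecMulVec_mulVec φ (v j)
    rw [hpj, dotProduct_zero] at this
    simpa using this.symm
  rw [← Finset.add_sum_erase _ _ hj, h0, zero_add,
    ← Finset.add_sum_erase _ (fun k => ‖star φ ⬝ᵥ v k‖ ^ 2) hj, h0, norm_zero, zero_pow two_ne_zero,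
    zero_add, ← Finset.cast_card_erase_of_mem hj]
  calc ‖∑ k ∈ T.erase j, star φ ⬝ᵥ v k‖ ^ 2 ≤ (∑ k ∈ T.erase j, ‖star φ ⬝ᵥ v k‖) ^ 2 := by
        gcongr; exact _root_.norm_sum_le _ _
    _ ≤ _ := sq_sum_le_card_mul_sum_sq

/-- Integer vectors spanning the rays of the four PBR states. -/
def pbrRay : Fin 4 → Fin 4 → ℤ :=
  ![![1, 0, 0, 0], ![1, 1, 0, 0], ![1, 0, 1, 0], ![1, 1, 1, 1]]

theorem pbrState_eq_rayProj (i : Fin 4) : pbrState i = rayProj (pbrRay i) := by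
  have hs : sqrt2⁻¹ * (starRingEnd ℂ) sqrt2⁻¹ = 2⁻¹ := by
    rw [sqrt2, ← Complex.ofReal_inv, Complex.conj_ofReal, ← Complex.ofReal_mul, ← mul_inv,
      Real.mul_self_sqrt (by norm_num)]
    simp
  have h4 : (2 : ℂ)⁻¹ * (starRingEnd ℂ) 2⁻¹ = 4⁻¹ := by
    rw [map_inv₀, Complex.conj_ofNat]; norm_num
  have key : ∀ (c r : ℂ) (w : Fin 4 → ℂ) (u : Fin 4 → ℤ), w = intVec u →
      c * (starRingEnd ℂ) c = r → r = ((u ⬝ᵥ u : ℤ) : ℂ)⁻¹ →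
      vecMulVec (c • w) (star (c • w)) = rayProj u := by
    rintro c r w u rfl hc hr
    rw [star_smul, star_intVec, smul_vecMulVec, vecMulVec_smul, smul_smul, rayProj, ← hr, ← hc,
      Complex.star_def]
  fin_cases i
  · have := key 1 1 (pbrVec 0) (pbrRay 0) (by ext i; fin_cases i <;> simp [pbrVec, pbrRay, intVec])
      (by simp) (by simp [pbrRay])
    simpa [pbrState] using this
  · exact key _ _ _ (pbrRay 1) (by ext i; fin_cases i <;> simp [pbrRay, intVec]) hs
      (by rw [show pbrRay 1 ⬝ᵥ pbrRay 1 = 2 by decide]; norm_num)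
  · exact key _ _ _ (pbrRay 2) (by ext i; fin_cases i <;> simp [pbrRay, intVec]) hs
      (by rw [show pbrRay 2 ⬝ᵥ pbrRay 2 = 2 by decide]; norm_num)
  · exact key _ _ _ (pbrRay 3) (by ext i; fin_cases i <;> simp [pbrRay, intVec]) h4
      (by rw [show pbrRay 3 ⬝ᵥ pbrRay 3 = 4 by decide]; norm_num)

theorem pbrRay_dotProduct_ne_zero (i j : Fin 4) : pbrRay i ⬝ᵥ pbrRay j ≠ 0 := by
  revert i j; decide

theorem pbrState_mul_ne_zero (i j : Fin 4) : pbrState i * pbrState j ≠ 0 := by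
  rw [pbrState_eq_rayProj, pbrState_eq_rayProj]
  exact rayProj_mul_ne_zero (pbrRay_dotProduct_ne_zero i i) (pbrRay_dotProduct_ne_zero j j)
    (pbrRay_dotProduct_ne_zero i j)

theorem mulVec_pbrRay_eq_zero {i : Fin 4} {p : Mat 4} (hp : IsPureState p)
    (h : pbrState i * p = 0) : p *ᵥ intVec (pbrRay i) = 0 := by
  obtain ⟨φ, -, rfl⟩ := hp
  have h1 := congrArg conjTranspose h
  rw [conjTranspose_mul, pbrState_eq_rayProj, conjTranspose_rayProj, conjTranspose_vecMulVec,
    star_star, conjTranspose_zero] at h1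
  rw [← rayProj_mulVec_self (pbrRay_dotProduct_ne_zero i i), mulVec_mulVec, h1, zero_mulVec]

/-- Weights for which the rescaled PBR rays have nearly equal norms. -/
def pbrWeight : Fin 4 → ℤ := ![4, 3, 3, 2]

/-- No context antidistinguishes three of the four PBR states. -/
theorem IsContext.exists_pbrState_mul_ne_zero {C : Finset (Mat 4)} (hC : IsContext C) (i : Fin 4) :
    ∃ p ∈ C, ∀ j, j ≠ i → pbrState j * p ≠ 0 := by
  by_contra! hcon
  let v : Fin 4 → Fin 4 → ℤ := fun j => pbrWeight j • pbrRay j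
  have hsum : ∑ j ∈ Finset.univ.erase i, intVec (v j)
      = intVec (∑ j ∈ Finset.univ.erase i, v j) := by
    ext k; simp [intVec]
  have hle := hC.norm_sum_le (Finset.univ.erase i) (fun j => intVec (v j)) fun p hp => by
    obtain ⟨j, hj, h0⟩ := hcon p hp
    refine ⟨j, by simpa using hj, ?_⟩
    have hv : intVec (v j) = (pbrWeight j : ℂ) • intVec (pbrRay j) := by
      ext k; simp [v, intVec]
    rw [hv, mulVec_smul, mulVec_pbrRay_eq_zero (hC.1 p hp) h0, smul_zero]
  simp_rw [hsum, star_intVec, intVec_dotProduct, Complex.intCast_re] at hle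
  have hlt : ∀ i : Fin 4, (((Finset.univ.erase i).card : ℤ) - 1) *
      ∑ j ∈ Finset.univ.erase i, v j ⬝ᵥ v j <
      (∑ j ∈ Finset.univ.erase i, v j) ⬝ᵥ ∑ j ∈ Finset.univ.erase i, v j := by
    decide
  exact absurd hle (not_le.mpr (by exact_mod_cast hlt i))

/-- The measurement basis of Pusey, Barrett and Rudolph: its `i`-th vector is orthogonal to the
`i`-th PBR state. -/
def pbrBasis : Fin 4 → Fin 4 → ℤ :=
  ![![0, 1, 1, 0], ![1, -1, 1, 1], ![1, 1, -1, 1], ![1, 0, 0, -1]]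

/-- For each `i`, an orthogonal basis starting with the `i`-th PBR state and the `i`-th element of
the PBR measurement basis. -/
def pbrCompletion : Fin 4 → Fin 4 → Fin 4 → ℤ :=
  ![![pbrRay 0, pbrBasis 0, ![0, 1, -1, 0], ![0, 0, 0, 1]],
    ![pbrRay 1, pbrBasis 1, ![0, 0, 1, -1], ![1, -1, -1, -1]],
    ![pbrRay 2, pbrBasis 2, ![0, 1, 0, -1], ![1, -1, -1, -1]],
    ![pbrRay 3, pbrBasis 3, ![0, 1, -1, 0], ![1, -1, -1, 1]]]

theorem isOrthogonalFamily_pbrBasis : IsOrthogonalFamily pbrBasis := by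
  unfold IsOrthogonalFamily; decide

theorem isOrthogonalFamily_pbrCompletion (i : Fin 4) : IsOrthogonalFamily (pbrCompletion i) := by
  revert i; unfold IsOrthogonalFamily; decide

theorem pbrCompletion_zero (i : Fin 4) : pbrCompletion i 0 = pbrRay i := by
  fin_cases i <;> rfl

theorem pbrCompletion_one (i : Fin 4) : pbrCompletion i 1 = pbrBasis i := by
  fin_cases i <;> rfl

theorem isContextualSet_image_pbrState : IsContextualSet (Finset.univ.image pbrState) := by
  refine ⟨Finset.univ.image fun x : Fin 4 × Fin 4 => rayProj (pbrCompletion x.1 x.2),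
    ⟨?_, ?_, ?_⟩, ?_⟩
  · simp only [Finset.mem_image, Finset.mem_univ, true_and, forall_exists_index,
      forall_apply_eq_imp_iff]
    exact fun x => isPureState_rayProj ((isOrthogonalFamily_pbrCompletion x.1).self_ne_zero x.2)
  · intro ρ hρ
    obtain ⟨i, -, rfl⟩ := Finset.mem_image.mp hρ
    exact Finset.mem_image.mpr
      ⟨(i, 0), Finset.mem_univ _, by rw [pbrState_eq_rayProj, pbrCompletion_zero]⟩
  · simp only [Finset.mem_image, Finset.mem_univ, true_and, forall_exists_index,
      forall_apply_eq_imp_iff]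
    rintro ⟨i, k⟩ hk
    have hU := isOrthogonalFamily_pbrCompletion i
    refine ⟨isPureState_rayProj (hU.self_ne_zero k), pbrState i,
      Finset.mem_image_of_mem _ (Finset.mem_univ i), ?_⟩
    rw [pbrState_eq_rayProj, ← pbrCompletion_zero]
    refine rayProj_mul_eq_zero ((hU 0 k).mpr ?_)
    rintro rfl
    exact hk ⟨i, by rw [pbrState_eq_rayProj, pbrCompletion_zero]⟩
  · rintro ⟨ν, hν, hone⟩
    have hmem : ∀ i k, rayProj (pbrCompletion i k) ∈
        Finset.univ.image fun x : Fin 4 × Fin 4 => rayProj (pbrCompletion x.1 x.2) :=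
      fun i k => Finset.mem_image.mpr ⟨(i, k), Finset.mem_univ _, rfl⟩
    have hzero : ∀ i, ν (rayProj (pbrBasis i)) = 0 := fun i => by
      rw [← pbrCompletion_one]
      refine (isOrthogonalFamily_pbrCompletion i).assignment_eq_zero hν (hmem i) zero_ne_one ?_
      rw [pbrCompletion_zero, ← pbrState_eq_rayProj]
      exact hone _ (Finset.mem_image_of_mem _ (Finset.mem_univ i))
    have hsum := isOrthogonalFamily_pbrBasis.sum_assignment hν fun i => by
      rw [← pbrCompletion_one]; exact hmem i 1
    simp [hzero] at hsum

/-- The set of the four PBR states is maximally contextual: it is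
contextual and no proper subset of it is contextual. -/
theorem statement_13 :
    MaximallyContextual
      ({pbrState 0, pbrState 1, pbrState 2, pbrState 3} : Finset (Mat 4)) := by
  have himage : ({pbrState 0, pbrState 1, pbrState 2, pbrState 3} : Finset (Mat 4)) =
      Finset.univ.image pbrState := by
    ext ρ
    simp [Fin.exists_fin_succ, eq_comm]
  rw [himage]
  refine ⟨isContextualSet_image_pbrState, fun S hS => ?_⟩
  have hsub := hS.subset
  obtain ⟨ρ, hρ, hρS⟩ := Finset.exists_of_ssubset hS
  obtain ⟨i, -, rfl⟩ := Finset.mem_image.mp hρ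
  refine not_isContextualSet (fun ρ hρ ρ' hρ' => ?_) fun C hC => ?_
  · obtain ⟨j, -, rfl⟩ := Finset.mem_image.mp (hsub hρ)
    obtain ⟨k, -, rfl⟩ := Finset.mem_image.mp (hsub hρ')
    exact pbrState_mul_ne_zero j k
  · obtain ⟨p, hp, hne⟩ := hC.exists_pbrState_mul_ne_zero i
    refine ⟨p, hp, fun ρ hρ => ?_⟩
    obtain ⟨j, -, rfl⟩ := Finset.mem_image.mp (hsub hρ)
    exact hne j fun h => hρS (h ▸ hρ)
end

section
/- The three pure states in ℂ³ given by the unit vectors y₁⁻ = (0,1,−1)/√2, y₂⁺ = (1,0,1)/√2, y₃⁻ = (1,−1,0)/√2 are pairwise non-orthogonal and are strongly antidistinguishable, with strongly antidistinguishing PVM given by the projections onto the standard basis vectors z₁ = (1,0,0), z₂ = (0,1,0), z₃ = (0,0,1): each zᵢ-projector annihilates the i-th state and has nonzero overlap with the other two. -/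
open Matrix

/-- The three Yu–Oh states `y₁⁻ = (0,1,−1)/√2`, `y₂⁺ = (1,0,1)/√2`,
`y₃⁻ = (1,−1,0)/√2` in `ℂ³`. -/
noncomputable def yuOhVec : Fin 3 → (Fin 3 → ℂ)
  | 0 => sqrt2⁻¹ • ![0, 1, -1]
  | 1 => sqrt2⁻¹ • ![1, 0, 1]
  | 2 => sqrt2⁻¹ • ![1, -1, 0]

/-- The three Yu–Oh pure states. -/
noncomputable def yuOhState (i : Fin 3) : Mat 3 :=
  vecMulVec (yuOhVec i) (star (yuOhVec i))

/-- The standard basis vectors `z₁ = (1,0,0)`, `z₂ = (0,1,0)`, `z₃ = (0,0,1)` of `ℂ³`. -/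
noncomputable def zVec (i : Fin 3) : Fin 3 → ℂ := Pi.single i 1

/-- The projections onto the standard basis vectors of `ℂ³`. -/
noncomputable def zProj (i : Fin 3) : Mat 3 :=
  vecMulVec (zVec i) (star (zVec i))

/-- The overlap of two pure states vanishes exactly when their vectors are orthogonal. -/
theorem trace_vecMulVec_star_mul_eq_zero_iff {n : Type*} [Fintype n] (v w : n → ℂ) :
    (vecMulVec v (star v) * vecMulVec w (star w)).trace = 0 ↔ star v ⬝ᵥ w = 0 := by
  have hconj : star w ⬝ᵥ v = star (star v ⬝ᵥ w) := star_dotProduct w v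
  rw [vecMulVec_mul_vecMulVec, trace_vecMulVec, dotProduct_smul, dotProduct_comm v, hconj,
    smul_eq_mul, mul_eq_zero, star_eq_zero, or_self]

theorem zProj_eq_single (i : Fin 3) : zProj i = single i i 1 := by
  simp [zProj, zVec, single_eq_single_vecMulVec_single, Pi.star_single]

theorem isPVMFam_zProj : IsPVMFam zProj := by
  refine ⟨fun i => ⟨?_, ?_⟩, fun i j hij => ?_, ?_⟩
  · simp [zProj_eq_single, IsHermitian, conjTranspose_single]
  · simp [zProj_eq_single]
  · simp [zProj_eq_single, hij]
  · simp only [zProj_eq_single, sum_single_one]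

theorem yuOhState_mul_trace_ne_zero {i j : Fin 3} (hij : i ≠ j) :
    (yuOhState i * yuOhState j).trace ≠ 0 := by
  rw [yuOhState, yuOhState, Ne, trace_vecMulVec_star_mul_eq_zero_iff]
  fin_cases i <;> fin_cases j <;>
    simp_all [yuOhVec, dotProduct, Fin.sum_univ_three, sqrt2_ne_zero]

theorem zProj_mul_yuOhState_trace_eq_zero_iff {i j : Fin 3} :
    (zProj i * yuOhState j).trace = 0 ↔ j = i := by
  rw [zProj, yuOhState, trace_vecMulVec_star_mul_eq_zero_iff]
  fin_cases i <;> fin_cases j <;>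
    simp [zVec, yuOhVec, dotProduct, Fin.sum_univ_three, sqrt2_ne_zero]

/-- The states `y₁⁻, y₂⁺, y₃⁻` are pairwise non-orthogonal and are
strongly antidistinguished by the standard-basis PVM `{z₁, z₂, z₃}`: each
`zᵢ`-projector annihilates the `i`-th state and has nonzero overlap with the other
two. -/
theorem statement_14 :
    (∀ i j : Fin 3, i ≠ j → (yuOhState i * yuOhState j).trace ≠ 0) ∧
    IsPVMFam zProj ∧
    (∀ j : Fin 3, ∃ i : Fin 3, (zProj j * yuOhState i).trace = 0) ∧
    ∀ i : Fin 3, (zProj i * yuOhState i).trace = 0 ∧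
      ∀ j : Fin 3, j ≠ i → (zProj i * yuOhState j).trace ≠ 0 := by
  exact ⟨fun _ _ => yuOhState_mul_trace_ne_zero, isPVMFam_zProj,
    fun j => ⟨j, zProj_mul_yuOhState_trace_eq_zero_iff.mpr rfl⟩,
    fun _ => ⟨zProj_mul_yuOhState_trace_eq_zero_iff.mpr rfl,
      fun _ h => mt zProj_mul_yuOhState_trace_eq_zero_iff.mp h⟩⟩
end

section
/- If a finite non-orthogonal set S of pure states is a contextual instance of a scenario X generated by S, then there exists a context C̃ ∈ ℂ(X) with C̃ ∩ S = ∅ such that every projector in C̃ is orthogonal to at least one state in S; consequently C̃, viewed as a PVM, weakly antidistinguishes S. -/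
open Matrix

/-- If a finite non-orthogonal set `S` of pure states is a contextual
instance of a scenario `X` generated by `S`, then there is a context `C̃ ∈ ℂ(X)` with
`C̃ ∩ S = ∅` all of whose projectors are orthogonal to some state of `S`; consequently
`C̃`, viewed as a PVM, weakly antidistinguishes `S`. -/
theorem statement_15 {d : ℕ} (S X : Finset (Mat d))
    (hpure : ∀ ρ ∈ S, IsPureState ρ) (hnon : NonOrthogonal S)
    (hgen : GeneratedScenario S X) (hci : ContextualInstance S X) :
    ∃ C : Finset (Mat d), C ⊆ X ∧ IsContext C ∧ (∀ p ∈ C, p ∉ S) ∧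
      (∀ σ ∈ C, ∃ ρ ∈ S, ρ * σ = 0) ∧
      WeaklyAntidistinguishes C S := by
  classical
  obtain ⟨-, -, himp⟩ := hgen
  have hC : ∃ C ⊆ X, IsContext C ∧ (C.filter (· ∈ S)).card ≠ 1 := by
    by_contra! h
    refine hci ⟨fun σ => if σ ∈ S then 1 else 0, ⟨fun σ _ => ?_, fun C hCX hC => ?_⟩,
      fun ρ hρ => if_pos hρ⟩
    · by_cases hσ : σ ∈ S <;> simp [hσ]
    · rw [← Finset.card_filter]
      exact h C hCX hC
  obtain ⟨C, hCX, hC, hcard⟩ := hC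
  have hle : (C.filter (· ∈ S)).card ≤ 1 := by
    refine Finset.card_le_one.2 fun p hp q hq => ?_
    rw [Finset.mem_filter] at hp hq
    by_contra hpq
    exact hnon p hp.2 q hq.2 hpq (by rw [hC.2.1 p hp.1 q hq.1 hpq, Matrix.trace_zero])
  have hzero : (C.filter (· ∈ S)).card = 0 := by omega
  have hdisj : ∀ p ∈ C, p ∉ S := fun p hp hpS =>
    Finset.filter_eq_empty_iff.1 (Finset.card_eq_zero.1 hzero) hp hpS
  have horth : ∀ σ ∈ C, ∃ ρ ∈ S, ρ * σ = 0 := fun σ hσ =>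
    (himp σ (hCX hσ) (hdisj σ hσ)).2
  refine ⟨C, hCX, hC, hdisj, horth, fun σ hσ => ?_⟩
  obtain ⟨ρ, hρ, h⟩ := horth σ hσ
  exact ⟨ρ, hρ, by rw [Matrix.trace_mul_comm, h, Matrix.trace_zero]⟩
end

section
/- The scenario X consisting of the thirteen Yu–Oh rank-1 projections in ℂ³ — onto the vectors h_0=(1,1,1), h_1=(−1,1,1), h_2=(1,−1,1), h_3=(1,1,−1), y_1^−=(0,1,−1), y_1^+=(0,1,1), y_2^−=(−1,0,1), y_2^+=(1,0,1), y_3^−=(1,−1,0), y_3^+=(1,1,0), z_1=(1,0,0), z_2=(0,1,0), z_3=(0,0,1) (normalized) — admits a noncontextual value assignment; i.e., there exists ν : X → {0,1} with Σ_{σ∈C} ν(σ) = 1 for every context C ∈ ℂ(X). -/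
open Matrix

/-- The rank-1 projection onto the span of a (nonzero) vector `v`, i.e. onto its
normalization. -/
noncomputable def projOf {n : ℕ} (v : Fin n → ℂ) : Mat n :=
  (star v ⬝ᵥ v)⁻¹ • vecMulVec v (star v)

/-- The thirteen Yu–Oh rank-1 projections in `ℂ³`. -/
noncomputable def yuOhX : Finset (Mat 3) :=
  {projOf ![1, 1, 1], projOf ![-1, 1, 1], projOf ![1, -1, 1], projOf ![1, 1, -1],
    projOf ![0, 1, -1], projOf ![0, 1, 1], projOf ![-1, 0, 1], projOf ![1, 0, 1],
    projOf ![1, -1, 0], projOf ![1, 1, 0],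
    projOf ![1, 0, 0], projOf ![0, 1, 0], projOf ![0, 0, 1]}

/-- The entries of `projOf v`. -/
lemma projOf_apply {n : ℕ} (v : Fin n → ℂ) (i j : Fin n) :
    projOf v i j = (star v ⬝ᵥ v)⁻¹ * (v i * star (v j)) := by
  simp [projOf, vecMulVec_apply]

/-- The four Yu–Oh projections with all components nonzero. -/
def IsDiagonalRay (σ : Mat 3) : Prop :=
  σ = projOf ![1, 1, 1] ∨ σ = projOf ![-1, 1, 1] ∨ σ = projOf ![1, -1, 1] ∨
    σ = projOf ![1, 1, -1]

lemma IsDiagonalRay.apply_zero_zero {σ : Mat 3} (h : IsDiagonalRay σ) : σ 0 0 = 1 / 3 := by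
  rcases h with rfl | rfl | rfl | rfl <;>
    (simp [projOf_apply, dotProduct, Fin.sum_univ_three]; try norm_num)

/-- Two diagonal rays are never orthogonal. -/
lemma IsDiagonalRay.mul_ne_zero {σ τ : Mat 3} (hσ : IsDiagonalRay σ) (hτ : IsDiagonalRay τ) :
    σ * τ ≠ 0 := by
  intro h
  have h00 := congrFun (congrFun h 0) 0
  rw [Matrix.mul_apply, Fin.sum_univ_three] at h00
  rcases hσ with rfl | rfl | rfl | rfl <;> rcases hτ with rfl | rfl | rfl | rfl <;>
    (simp [projOf_apply, dotProduct, Fin.sum_univ_three] at h00; try norm_num at h00)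

/-- The sum of the first row, a linear functional taking values in `{0, 1}` on all Yu–Oh
projections other than the diagonal rays. -/
def firstRowSum (σ : Mat 3) : ℂ := ∑ j, σ 0 j

lemma yuOhX_cases {σ : Mat 3} (h : σ ∈ yuOhX) :
    IsDiagonalRay σ ∨
      ((∃ n : ℕ, σ 0 0 = n / 2) ∧ (firstRowSum σ = 0 ∨ firstRowSum σ = 1)) := by
  simp only [yuOhX, Finset.mem_insert, Finset.mem_singleton] at h
  have key : ∀ n : ℕ, σ 0 0 = n / 2 → (firstRowSum σ = 0 ∨ firstRowSum σ = 1) →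
      IsDiagonalRay σ ∨
        ((∃ n : ℕ, σ 0 0 = n / 2) ∧ (firstRowSum σ = 0 ∨ firstRowSum σ = 1)) :=
    fun n h₁ h₂ => Or.inr ⟨⟨n, h₁⟩, h₂⟩
  rcases h with h | h | h | h | h | h | h | h | h | h | h | h | h
  iterate 4 exact Or.inl (by simp [IsDiagonalRay, h])
  iterate 2
    refine key 0 ?_ ?_ <;> subst h <;>
      simp [firstRowSum, projOf_apply, dotProduct, Fin.sum_univ_three]
  iterate 4
    refine key 1 ?_ ?_ <;> subst h <;>
      (simp [firstRowSum, projOf_apply, dotProduct, Fin.sum_univ_three]; try norm_num)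
  · refine key 2 ?_ ?_ <;> subst h <;>
      simp [firstRowSum, projOf_apply, dotProduct, Fin.sum_univ_three]
  iterate 2
    refine key 0 ?_ ?_ <;> subst h <;>
      simp [firstRowSum, projOf_apply, dotProduct, Fin.sum_univ_three]

/-- No context drawn from the Yu–Oh scenario contains a diagonal ray. -/
lemma IsContext.not_isDiagonalRay {C : Finset (Mat 3)} (hC : IsContext C) (hX : C ⊆ yuOhX)
    {σ : Mat 3} (hσ : σ ∈ C) : ¬ IsDiagonalRay σ := by
  classical
  intro h
  have half : ∀ τ ∈ C.erase σ, ∃ n : ℕ, τ 0 0 = n / 2 := fun τ hτ => by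
    obtain ⟨hne, hτC⟩ := Finset.mem_erase.1 hτ
    exact ((yuOhX_cases (hX hτC)).resolve_left
      fun h' => h.mul_ne_zero h' (hC.2.1 σ hσ τ hτC hne.symm)).1
  choose! n hn using half
  have hsum : ∑ τ ∈ C, τ 0 0 = 1 := by
    simpa [Matrix.sum_apply] using congrFun (congrFun hC.2.2 0) 0
  rw [← Finset.add_sum_erase _ _ hσ, h.apply_zero_zero, Finset.sum_congr rfl hn,
    ← Finset.sum_div, ← Nat.cast_sum] at hsum
  have h6 : ((2 + 3 * ∑ τ ∈ C.erase σ, n τ : ℕ) : ℂ) = (6 : ℕ) := by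
    push_cast at hsum ⊢
    linear_combination 6 * hsum
  have := Nat.cast_injective h6
  omega

/-- The Yu–Oh scenario of thirteen rank-1 projections admits a
noncontextual value assignment. -/
theorem statement_19 :
    ∃ ν : Mat 3 → ℕ, NoncontextualAssignment yuOhX ν := by
  classical
  refine ⟨fun σ => if firstRowSum σ = 1 then 1 else 0,
    fun σ _ => by dsimp only; split_ifs <;> simp, fun C hX hC => ?_⟩
  have hν : ∀ σ ∈ C, ((if firstRowSum σ = 1 then 1 else 0 : ℕ) : ℂ) = firstRowSum σ :=
    fun σ hσ => by
      rcases ((yuOhX_cases (hX hσ)).resolve_left (hC.not_isDiagonalRay hX hσ)).2 with h | h <;>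
        simp [h]
  have hsum : ∑ σ ∈ C, firstRowSum σ = 1 := by
    have hrow : firstRowSum (∑ σ ∈ C, σ) = 1 := by
      simp [hC.2.2, firstRowSum, Matrix.one_apply]
    rw [← hrow]
    simp only [firstRowSum, Matrix.sum_apply]
    exact Finset.sum_comm
  rw [← Finset.sum_congr rfl hν, ← Nat.cast_sum] at hsum
  exact_mod_cast hsum
end
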